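/- Let d and m be natural numbers, p ∈ EuclideanSpace ℝ (Fin d), and for each i ∈ Fin m let q_i, δ_i ∈ EuclideanSpace ℝ (Fin d) and r_i ∈ ℝ. Set L1_i = σ(⟪p, q_i⟫) − r_i, L2_i = σ(⟪p, q_i⟫)·(1 − σ(⟪p, q_i⟫)), and h_i = ⟪p, δ_i⟫. Then ‖ ∑_i [ (σ(⟪p, q_i + δ_i⟫) − r_i) • (q_i + δ_i) − L1_i • q_i ] − ∑_i [ (L2_i · h_i) • q_i + L1_i • δ_i ] ‖ ≤ ∑_i [ (1/4)·|h_i|·‖δ_i‖ + (h_i²/8)·(‖q_i‖ + ‖δ_i‖) ]. -/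

import Mathlib

open scoped RealInnerProductSpace BigOperators

noncomputable def sigmoid (x : ℝ) : ℝ := 1 / (1 + Real.exp (-x))

lemma sg_pos (x : ℝ) : 0 < sigmoid x ∧ sigmoid x < 1 := by
  have h : sigmoid x = Real.sigmoid x := by simp [sigmoid, Real.sigmoid_def]
  rw [h]
  exact ⟨Real.sigmoid_pos x, Real.sigmoid_lt_one x⟩

lemma sg_deriv (x : ℝ) : HasDerivAt sigmoid (sigmoid x * (1 - sigmoid x)) x := by
  have h : sigmoid = Real.sigmoid := by
    funext x
    simp [sigmoid, Real.sigmoid_def]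
  rw [h]
  exact Real.hasDerivAt_sigmoid x

lemma sg_deriv2 (x : ℝ) : HasDerivAt (fun x => sigmoid x * (1 - sigmoid x))
    (sigmoid x * (1 - sigmoid x) * (1 - 2 * sigmoid x)) x := by
  have h := (sg_deriv x).mul ((sg_deriv x).const_sub 1)
  refine h.congr_deriv ?_
  ring

lemma sg_bd (x : ℝ) : |sigmoid x * (1 - sigmoid x)| ≤ 1 / 4 := by
  obtain ⟨h0, h1⟩ := sg_pos x
  rw [abs_le]
  constructor <;> nlinarith [sq_nonneg (1 - 2 * sigmoid x)]

lemma sg_bd2 (x : ℝ) : |sigmoid x * (1 - sigmoid x) * (1 - 2 * sigmoid x)| ≤ 1 / 4 := by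
  obtain ⟨h0, h1⟩ := sg_pos x
  rw [abs_mul]
  have h2 : |1 - 2 * sigmoid x| ≤ 1 := by
    rw [abs_le]
    constructor <;> linarith
  calc _ ≤ 1 / 4 * 1 := mul_le_mul (sg_bd x) h2 (abs_nonneg _) (by norm_num)
    _ = _ := by norm_num

lemma tangent (f f' : ℝ → ℝ) (hf : ∀ x, HasDerivAt f (f' x) x) (hm : Monotone f') (x y : ℝ) :
    f x + f' x * (y - x) ≤ f y := by
  have hc : Continuous f := continuous_iff_continuousAt.2 fun x => (hf x).continuousAt
  rcases lt_trichotomy x y with h | h | h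
  · obtain ⟨c, hc1, hc2⟩ := exists_hasDerivAt_eq_slope f f' h hc.continuousOn (fun x _ => hf x)
    rw [eq_div_iff (by linarith)] at hc2
    nlinarith [hm hc1.1.le]
  · subst h
    simp
  · obtain ⟨c, hc1, hc2⟩ := exists_hasDerivAt_eq_slope f f' h hc.continuousOn (fun x _ => hf x)
    rw [eq_div_iff (by linarith)] at hc2
    nlinarith [hm hc1.2.le]

lemma sg_lip (a h : ℝ) : |sigmoid (a + h) - sigmoid a| ≤ 1 / 4 * |h| := by
  have := Convex.norm_image_sub_le_of_norm_hasDerivWithin_le (s := Set.univ) (f := sigmoid)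
    (C := 1 / 4) (x := a) (y := a + h) (fun x _ => (sg_deriv x).hasDerivWithinAt)
    (fun x _ => sg_bd x) convex_univ trivial trivial
  simpa using this

lemma sg_aux (e : ℝ) (he : |e| = 1) (a h : ℝ) :
    e * (sigmoid (a + h) - sigmoid a - sigmoid a * (1 - sigmoid a) * h) ≤ h ^ 2 / 8 := by
  have hf : ∀ x, HasDerivAt (fun x => x ^ 2 / 8 - e * sigmoid x)
      (x / 4 - e * (sigmoid x * (1 - sigmoid x))) x := by
    intro x
    have := ((hasDerivAt_pow 2 x).div_const 8).sub ((sg_deriv x).const_mul e)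
    refine this.congr_deriv ?_
    norm_num
    ring
  have hg : ∀ x, HasDerivAt (fun x => x / 4 - e * (sigmoid x * (1 - sigmoid x)))
      (1 / 4 - e * (sigmoid x * (1 - sigmoid x) * (1 - 2 * sigmoid x))) x := fun x =>
    ((hasDerivAt_id x).div_const 4).sub ((sg_deriv2 x).const_mul e)
  have hm : Monotone (fun x => x / 4 - e * (sigmoid x * (1 - sigmoid x))) := by
    refine monotone_of_deriv_nonneg (fun x => (hg x).differentiableAt) fun x => ?_
    rw [(hg x).deriv]
    have h1 := sg_bd2 x
    have h2 := le_abs_self (e * (sigmoid x * (1 - sigmoid x) * (1 - 2 * sigmoid x)))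
    rw [abs_mul, he] at h2
    linarith
  have := tangent _ _ hf hm a (a + h)
  nlinarith

lemma sg_rem (a h : ℝ) :
    |sigmoid (a + h) - sigmoid a - sigmoid a * (1 - sigmoid a) * h| ≤ h ^ 2 / 8 := by
  have h1 := sg_aux 1 (by simp) a h
  have h2 := sg_aux (-1) (by simp) a h
  rw [abs_le]
  constructor <;> linarith

theorem stmt8 (d m : ℕ) (p : EuclideanSpace ℝ (Fin d))
    (q δ : Fin m → EuclideanSpace ℝ (Fin d)) (r : Fin m → ℝ) :
    ‖(∑ i : Fin m,
        ((sigmoid ⟪p, q i + δ i⟫ - r i) • (q i + δ i)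
          - (sigmoid ⟪p, q i⟫ - r i) • q i))
      - ∑ i : Fin m,
        ((sigmoid ⟪p, q i⟫ * (1 - sigmoid ⟪p, q i⟫) * ⟪p, δ i⟫) • q i
          + (sigmoid ⟪p, q i⟫ - r i) • δ i)‖
      ≤ ∑ i : Fin m,
        ((1 / 4) * |⟪p, δ i⟫| * ‖δ i‖
          + (⟪p, δ i⟫ ^ 2 / 8) * (‖q i‖ + ‖δ i‖)) := by
  rw [← Finset.sum_sub_distrib]
  refine (norm_sum_le _ _).trans (Finset.sum_le_sum fun i _ => ?_)
  rw [inner_add_right]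
  have h1 := sg_lip ⟪p, q i⟫ ⟪p, δ i⟫
  have h2 := sg_rem ⟪p, q i⟫ ⟪p, δ i⟫
  generalize ⟪p, q i⟫ = a at *
  generalize ⟪p, δ i⟫ = h at *
  have e : ((sigmoid (a + h) - r i) • (q i + δ i) - (sigmoid a - r i) • q i)
      - ((sigmoid a * (1 - sigmoid a) * h) • q i + (sigmoid a - r i) • δ i)
      = (sigmoid (a + h) - sigmoid a) • δ i
        + (sigmoid (a + h) - sigmoid a - sigmoid a * (1 - sigmoid a) * h) • q i := by
    module
  rw [e]
  refine (norm_add_le _ _).trans ?_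
  rw [norm_smul, norm_smul, Real.norm_eq_abs, Real.norm_eq_abs]
  have h3 := mul_le_mul_of_nonneg_right h1 (norm_nonneg (δ i))
  have h4 := mul_le_mul_of_nonneg_right h2 (norm_nonneg (q i))
  have h5 : 0 ≤ h ^ 2 / 8 * ‖δ i‖ := by positivity
  linarith
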